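/- Let (Γ, A) be an E-GCM graph with geometric representation σ of its Coxeter group W on V, and suppose w.α_i = Kα_x for some w ∈ W, i, x ∈ I, and K > 0 with w ≠ ε. Then there exist an ON-path 𝒫 from γ_i to γ_x and ER-sequences 𝒮_k rooted at the nodes of 𝒫 such that w equals the alternating product w_{𝒮_p} v_{i_p i_{p−1}} ··· v_{i_1 i_0} w_{𝒮_0}, and K = Π_𝒫. -/

import Mathlib

open Real

variable {n : ℕ}

/-- E-generalized Cartan matrix: diagonal entries 2, off-diagonal entries nonpositive,
`a_{ij} = 0 ↔ a_{ji} = 0`, and each off-diagonal product is `≥ 4` or of the form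
`4cos²(π/k)` for an integer `k ≥ 2`. -/
def IsEGCM (A : Fin n → Fin n → ℝ) : Prop :=
  (∀ i, A i i = 2) ∧
  (∀ i j, i ≠ j → A i j ≤ 0) ∧
  (∀ i j, A i j = 0 → A j i = 0) ∧
  (∀ i j, i ≠ j → A i j * A j i ≥ 4 ∨
    ∃ k : ℕ, 2 ≤ k ∧ A i j * A j i = 4 * (Real.cos (Real.pi / k)) ^ 2)

/-- The Coxeter exponent `m_{ij}` (with `0` encoding `∞`). -/
noncomputable def mval (A : Fin n → Fin n → ℝ) (i j : Fin n) : ℕ :=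
  open scoped Classical in
  if h : ∃ k : ℕ, 2 ≤ k ∧ A i j * A j i = 4 * (Real.cos (Real.pi / k)) ^ 2
  then h.choose else 0

/-- The generating "reflection" `S_i(v) = v - 2B(α_i, v)α_i` where `B(α_i, α_j) = a_{ij}/2`
and the simple roots `α_i` are the standard basis vectors of `Fin n → ℝ`. -/
noncomputable def S (A : Fin n → Fin n → ℝ) (i : Fin n) : Function.End (Fin n → ℝ) :=
  fun v => v - (∑ j, A i j * v j) • (Pi.single i (1 : ℝ) : Fin n → ℝ)

/-- The representing group `σ(W)`, as the monoid generated by the reflections `S_i`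
(each `S_i` is an involution, so this is a group of transformations). -/
noncomputable def Wgrp (A : Fin n → Fin n → ℝ) : Submonoid (Function.End (Fin n → ℝ)) :=
  Submonoid.closure (Set.range (S A))

/-- The simple root `α_i`. -/
noncomputable def simple (i : Fin n) : Fin n → ℝ := Pi.single i 1

/-- The root system `Φ = {w.α_i}`. -/
noncomputable def Phi (A : Fin n → Fin n → ℝ) : Set (Fin n → ℝ) :=
  {v | ∃ w ∈ Wgrp A, ∃ i, w (simple i) = v}

/-- Positive roots. -/
noncomputable def PhiPos (A : Fin n → Fin n → ℝ) : Set (Fin n → ℝ) :=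
  {v | v ∈ Phi A ∧ ∀ j, 0 ≤ v j}

/-- Negative roots. -/
noncomputable def PhiNeg (A : Fin n → Fin n → ℝ) : Set (Fin n → ℝ) :=
  {v | v ∈ Phi A ∧ ∀ j, v j ≤ 0}

/-- `𝔖(α)`: the positive roots which are real scalar multiples of `α`. -/
noncomputable def Sfrak (A : Fin n → Fin n → ℝ) (α : Fin n → ℝ) : Set (Fin n → ℝ) :=
  {β | β ∈ PhiPos A ∧ ∃ K : ℝ, β = K • α}

/-- `N(w)`: the positive roots sent to negative roots by `w`. -/
noncomputable def Nset (A : Fin n → Fin n → ℝ) (w : Function.End (Fin n → ℝ)) :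
    Set (Fin n → ℝ) :=
  {α | α ∈ PhiPos A ∧ w α ∈ PhiNeg A}

/-- The Coxeter length of `w`: the least length of a word in the generators `S_i`
representing `w`. -/
noncomputable def len (A : Fin n → Fin n → ℝ) (w : Function.End (Fin n → ℝ)) : ℕ :=
  sInf {p | ∃ l : List (Fin n), l.length = p ∧ (l.map (S A)).prod = w}

/-- `γ_i` and `γ_j` are odd neighbors: `m_{ij}` is odd (in particular finite). -/
def OddNbr (A : Fin n → Fin n → ℝ) (i j : Fin n) : Prop := i ≠ j ∧ Odd (mval A i j)

/-- The scalar `K_{ji} = -a_{ji}/(2cos(π/m_{ij}))`. -/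
noncomputable def Kval (A : Fin n → Fin n → ℝ) (j i : Fin n) : ℝ :=
  -(A j i) / (2 * Real.cos (Real.pi / (mval A j i)))

/-- The scalar `Π_𝒫` attached to an ON-path `𝒫`: the product of the `K`'s along its steps. -/
noncomputable def pathProd (A : Fin n → Fin n → ℝ) : List (Fin n) → ℝ
  | [] => 1
  | [_] => 1
  | i :: j :: t => Kval A j i * pathProd A (j :: t)

/-- An ON-path: consecutive nodes are odd neighbors. -/
def IsONPath (A : Fin n → Fin n → ℝ) (l : List (Fin n)) : Prop := l.Chain' (OddNbr A)

/-- An ON-cycle: an ON-path of nonzero length whose start and end nodes coincide. -/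
def IsONCycle (A : Fin n → Fin n → ℝ) (l : List (Fin n)) : Prop :=
  IsONPath A l ∧ 2 ≤ l.length ∧ l.head? = l.getLast?

/-- `(Γ, A)` is unital ON-cyclic: `Π_𝒞 = 1` for every ON-cycle `𝒞`. -/
def UnitalONCyclic (A : Fin n → Fin n → ℝ) : Prop :=
  ∀ l : List (Fin n), IsONCycle A l → pathProd A l = 1

/-- For odd `m_{ij}`, `v_{ji} := (s_is_j)^{(m_{ij}-1)/2}`. -/
noncomputable def vO (A : Fin n → Fin n → ℝ) (j i : Fin n) : Function.End (Fin n → ℝ) :=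
  (S A i * S A j) ^ ((mval A i j - 1) / 2)

/-- For even `m_{ij}`, `v_{ji} := s_j(s_is_j)^{(m_{ij}-2)/2}`. -/
noncomputable def vE (A : Fin n → Fin n → ℝ) (j i : Fin n) : Function.End (Fin n → ℝ) :=
  S A j * (S A i * S A j) ^ ((mval A i j - 2) / 2)

/-- `γ_i` and `γ_j` are even-related: `m_{ij}` is even and finite. -/
def EvenRel (A : Fin n → Fin n → ℝ) (i j : Fin n) : Prop :=
  i ≠ j ∧ mval A i j ≠ 0 ∧ Even (mval A i j)

/-- `w_𝒮` for an ER-sequence `𝒮` rooted at `i0` recorded as the list of its second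
coordinates `[j_1, …, j_p]`: the product `v_{j_p i_0} ⋯ v_{j_1 i_0}`. -/
noncomputable def wER (A : Fin n → Fin n → ℝ) (i0 : Fin n) (s : List (Fin n)) :
    Function.End (Fin n → ℝ) :=
  (s.reverse.map (fun j => vE A j i0)).prod

/-- The alternating product `w_{𝒮_p} v_{i_p i_{p-1}} ⋯ v_{i_1 i_0} w_{𝒮_0}` attached to a
list of pairs (node of the ON-path, its attached ER-sequence). -/
noncomputable def altProd (A : Fin n → Fin n → ℝ) :
    List (Fin n × List (Fin n)) → Function.End (Fin n → ℝ)
  | [] => 1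
  | [(i, s)] => wER A i s
  | (i, s) :: (j, t) :: rest => altProd A ((j, t) :: rest) * (vO A j i * wER A i s)

open CoxeterSystem (alternatingWord)

/-! ### The dihedral recursion -/

/-- The rescaled Chebyshev numbers: `dihedralCoeff (2 * cos θ) k = sin (k * θ) / sin θ`. -/
def dihedralCoeff (t : ℝ) : ℕ → ℝ
  | 0 => 0
  | 1 => 1
  | k + 2 => t * dihedralCoeff t (k + 1) - dihedralCoeff t k

lemma dihedralCoeff_two_mul_cos_mul_sin (θ : ℝ) (k : ℕ) :
    dihedralCoeff (2 * cos θ) k * sin θ = sin (k * θ) := by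
  induction k using Nat.twoStepInduction with
  | zero => simp [dihedralCoeff]
  | one => simp [dihedralCoeff]
  | more k h₀ h₁ =>
    have hsum : sin ((k + 2 : ℕ) * θ) + sin (k * θ) = 2 * cos θ * sin ((k + 1 : ℕ) * θ) := by
      have h₂ : ((k + 2 : ℕ) : ℝ) * θ = ((k + 1 : ℕ) : ℝ) * θ + θ := by push_cast; ring
      have h₃ : (k : ℝ) * θ = ((k + 1 : ℕ) : ℝ) * θ - θ := by push_cast; ring
      rw [h₂, h₃, sin_add, sin_sub]
      ring
    rw [dihedralCoeff, sub_mul, h₀, mul_assoc, h₁]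
    linarith

lemma sin_pi_div_pos {m : ℕ} (hm : 2 ≤ m) : 0 < sin (π / m) := by
  have hm' : (2 : ℝ) ≤ m := by exact_mod_cast hm
  refine sin_pos_of_pos_of_lt_pi (by positivity) ?_
  rw [div_lt_iff₀ (by linarith)]
  nlinarith [pi_pos]

lemma dihedralCoeff_pos_of_lt {m k : ℕ} (hm : 2 ≤ m) (hk : 0 < k) (hkm : k < m) :
    0 < dihedralCoeff (2 * cos (π / m)) k := by
  have hm' : (0 : ℝ) < m := by exact_mod_cast (by omega : 0 < m)
  have hk' : (0 : ℝ) < k := by exact_mod_cast hk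
  have hkm' : (k : ℝ) < m := by exact_mod_cast hkm
  have h : 0 < sin (k * (π / m)) := by
    refine sin_pos_of_pos_of_lt_pi (by positivity) ?_
    rw [mul_div_assoc', div_lt_iff₀ hm']
    nlinarith [pi_pos]
  rw [← dihedralCoeff_two_mul_cos_mul_sin] at h
  exact pos_of_mul_pos_left h (sin_pi_div_pos hm).le

lemma dihedralCoeff_self {m : ℕ} (hm : 2 ≤ m) : dihedralCoeff (2 * cos (π / m)) m = 0 := by
  have hm' : (m : ℝ) ≠ 0 := by exact_mod_cast (by omega : m ≠ 0)
  have h := dihedralCoeff_two_mul_cos_mul_sin (π / m) m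
  rw [mul_div_cancel₀ _ hm', sin_pi] at h
  exact (mul_eq_zero.mp h).resolve_right (sin_pi_div_pos hm).ne'

lemma dihedralCoeff_pred {m : ℕ} (hm : 2 ≤ m) :
    dihedralCoeff (2 * cos (π / m)) (m - 1) = 1 := by
  have hm' : (m : ℝ) ≠ 0 := by exact_mod_cast (by omega : m ≠ 0)
  have h := dihedralCoeff_two_mul_cos_mul_sin (π / m) (m - 1)
  have harg : ((m - 1 : ℕ) : ℝ) * (π / m) = π - π / m := by
    rw [Nat.cast_sub (by omega)]
    field_simp
    simp
  rw [harg, sin_pi_sub] at h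
  exact mul_right_cancel₀ (sin_pi_div_pos hm).ne' (h.trans (one_mul _).symm)

lemma dihedralCoeff_succ_self {m : ℕ} (hm : 2 ≤ m) :
    dihedralCoeff (2 * cos (π / m)) (m + 1) = -1 := by
  obtain ⟨k, rfl⟩ : ∃ k, m = k + 1 := ⟨m - 1, by omega⟩
  have h₁ := dihedralCoeff_pred hm
  rw [Nat.add_sub_cancel] at h₁
  rw [dihedralCoeff, dihedralCoeff_self hm, h₁]
  ring

lemma dihedralCoeff_pos_of_two_le {t : ℝ} (ht : 2 ≤ t) {k : ℕ} (hk : 0 < k) :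
    0 < dihedralCoeff t k := by
  have h : ∀ k, 0 ≤ dihedralCoeff t k ∧ dihedralCoeff t k + 1 ≤ dihedralCoeff t (k + 1) := by
    intro k
    induction k with
    | zero => simp [dihedralCoeff]
    | succ k ih =>
      refine ⟨by linarith, ?_⟩
      rw [dihedralCoeff]
      nlinarith
  obtain ⟨l, rfl⟩ : ∃ l, k = l + 1 := ⟨k - 1, by omega⟩
  linarith [h l]

/-! ### Coxeter exponents -/

variable {A : Fin n → Fin n → ℝ}

lemma mval_comm (A : Fin n → Fin n → ℝ) (i j : Fin n) : mval A i j = mval A j i := by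
  have h : A i j * A j i = A j i * A i j := mul_comm _ _
  unfold mval
  rw [h]

lemma mval_spec {i j : Fin n} (h : mval A i j ≠ 0) :
    2 ≤ mval A i j ∧ A i j * A j i = 4 * cos (π / mval A i j) ^ 2 := by
  unfold mval at h ⊢
  split_ifs at h ⊢ with hk
  · exact hk.choose_spec
  · exact absurd rfl h

lemma IsEGCM.four_le_of_mval_eq_zero (hA : IsEGCM A) {i j : Fin n} (hij : i ≠ j)
    (h : mval A i j = 0) : 4 ≤ A i j * A j i := by
  refine (hA.2.2.2 i j hij).resolve_right fun hk => ?_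
  rw [mval, dif_pos hk] at h
  have := hk.choose_spec.1
  omega

lemma cos_pi_div_nonneg {m : ℕ} (hm : 2 ≤ m) : 0 ≤ cos (π / m) := by
  have hm' : (2 : ℝ) ≤ m := by exact_mod_cast hm
  refine cos_nonneg_of_neg_pi_div_two_le_of_le
    (by linarith [pi_pos, show 0 ≤ π / m by positivity]) ?_
  exact div_le_div_of_nonneg_left pi_pos.le two_pos hm'

lemma cos_pi_div_pos {m : ℕ} (hm : 3 ≤ m) : 0 < cos (π / m) := by
  have hcast : (2 : ℝ) < m := by exact_mod_cast hm
  refine cos_pos_of_mem_Ioo ⟨by linarith [pi_pos, show 0 ≤ π / m by positivity], ?_⟩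
  exact div_lt_div_of_pos_left pi_pos two_pos hcast

/-- The trace parameter `t` and the scale `r` of the rank two subsystem on `i, j`. -/
structure IsDihedralScale (A : Fin n → Fin n → ℝ) (i j : Fin n) (t r : ℝ) : Prop where
  pos : 0 < r
  left : -A j i = t * r
  right : -A i j * r = t
  cases : (mval A i j = 0 ∧ 2 ≤ t) ∨ (2 ≤ mval A i j ∧ t = 2 * cos (π / mval A i j))

lemma IsEGCM.exists_isDihedralScale (hA : IsEGCM A) {i j : Fin n} (hij : i ≠ j) :
    ∃ t r, IsDihedralScale A i j t r := by
  obtain ⟨t, ht, hprod, hcases⟩ : ∃ t : ℝ, 0 ≤ t ∧ A i j * A j i = t ^ 2 ∧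
      ((mval A i j = 0 ∧ 2 ≤ t) ∨ (2 ≤ mval A i j ∧ t = 2 * cos (π / mval A i j))) := by
    by_cases h : mval A i j = 0
    · have h4 := hA.four_le_of_mval_eq_zero hij h
      refine ⟨√(A i j * A j i), sqrt_nonneg _, (sq_sqrt (by linarith)).symm, Or.inl ⟨h, ?_⟩⟩
      exact le_sqrt_of_sq_le (by linarith)
    · obtain ⟨h2, hprod⟩ := mval_spec h
      exact ⟨_, mul_nonneg zero_le_two (cos_pi_div_nonneg h2), by rw [hprod]; ring,
        Or.inr ⟨h2, rfl⟩⟩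
  rcases ht.eq_or_lt with rfl | ht
  · have h0 : A i j = 0 ∧ A j i = 0 := by
      rcases mul_eq_zero.mp (hprod.trans (by norm_num)) with h | h
      · exact ⟨h, hA.2.2.1 _ _ h⟩
      · exact ⟨hA.2.2.1 _ _ h, h⟩
    exact ⟨0, 1, one_pos, by simp [h0], by simp [h0], hcases⟩
  · have hji : A j i ≠ 0 := fun h => by
      rw [h, mul_zero] at hprod
      nlinarith
    have hneg : A j i < 0 := lt_of_le_of_ne (hA.2.1 j i hij.symm) hji
    refine ⟨t, -A j i / t, div_pos (by linarith) ht, by field_simp, ?_, hcases⟩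
    field_simp
    linarith

/-! ### Words in the reflections -/

/-- The transformation represented by a word. -/
noncomputable def wordProd (A : Fin n → Fin n → ℝ) (l : List (Fin n)) :
    Function.End (Fin n → ℝ) :=
  (l.map (S A)).prod

@[simp] lemma wordProd_nil : wordProd A [] = 1 := rfl

@[simp] lemma wordProd_cons (i : Fin n) (l : List (Fin n)) :
    wordProd A (i :: l) = S A i * wordProd A l := by
  simp [wordProd]

@[simp] lemma wordProd_append (l l' : List (Fin n)) :
    wordProd A (l ++ l') = wordProd A l * wordProd A l' := by
  simp [wordProd]

lemma exists_wordProd_of_mem_Wgrp {w : Function.End (Fin n → ℝ)} (hw : w ∈ Wgrp A) :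
    ∃ l, wordProd A l = w := by
  induction hw using Submonoid.closure_induction with
  | mem w hw =>
    obtain ⟨i, rfl⟩ := hw
    exact ⟨[i], by simp⟩
  | one => exact ⟨[], rfl⟩
  | mul w w' _ _ h h' =>
    obtain ⟨l, rfl⟩ := h
    obtain ⟨l', rfl⟩ := h'
    exact ⟨l ++ l', by simp⟩

lemma S_apply (i : Fin n) (v : Fin n → ℝ) :
    S A i v = v - (∑ k, A i k * v k) • simple i := rfl

lemma end_mul_apply (f g : Function.End (Fin n → ℝ)) (v : Fin n → ℝ) : (f * g) v = f (g v) := rfl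

lemma end_one_apply (v : Fin n → ℝ) : (1 : Function.End (Fin n → ℝ)) v = v := rfl

/-- The reflection `S A i` as a linear map. -/
noncomputable def reflLinear (A : Fin n → Fin n → ℝ) (i : Fin n) :
    (Fin n → ℝ) →ₗ[ℝ] (Fin n → ℝ) where
  toFun := S A i
  map_add' u v := by
    simp only [S_apply, Pi.add_apply, mul_add, Finset.sum_add_distrib, add_smul]
    abel
  map_smul' c v := by
    have h : ∑ k, A i k * (c • v) k = c * ∑ k, A i k * v k := by
      rw [Finset.mul_sum]
      exact Finset.sum_congr rfl fun k _ => by simp only [Pi.smul_apply, smul_eq_mul]; ring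
    simp only [S_apply, h, RingHom.id_apply, smul_sub, mul_smul]

lemma exists_linear_eq_wordProd (A : Fin n → Fin n → ℝ) (l : List (Fin n)) :
    ∃ f : (Fin n → ℝ) →ₗ[ℝ] (Fin n → ℝ), ∀ v, wordProd A l v = f v := by
  induction l with
  | nil => exact ⟨LinearMap.id, fun v => rfl⟩
  | cons i l ih =>
    obtain ⟨f, hf⟩ := ih
    exact ⟨(reflLinear A i).comp f, fun v => by
      rw [wordProd_cons, end_mul_apply, hf]; rfl⟩

lemma wordProd_add (l : List (Fin n)) (u v : Fin n → ℝ) :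
    wordProd A l (u + v) = wordProd A l u + wordProd A l v := by
  obtain ⟨f, hf⟩ := exists_linear_eq_wordProd A l
  simp [hf]

lemma wordProd_smul (l : List (Fin n)) (c : ℝ) (v : Fin n → ℝ) :
    wordProd A l (c • v) = c • wordProd A l v := by
  obtain ⟨f, hf⟩ := exists_linear_eq_wordProd A l
  simp [hf]

lemma S_simple (i j : Fin n) : S A i (simple j) = simple j - A i j • simple i := by
  rw [S_apply]
  congr 2
  simp [simple, Pi.single_apply]

lemma S_add (i : Fin n) (u v : Fin n → ℝ) : S A i (u + v) = S A i u + S A i v :=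
  (reflLinear A i).map_add u v

lemma S_smul (i : Fin n) (c : ℝ) (v : Fin n → ℝ) : S A i (c • v) = c • S A i v :=
  (reflLinear A i).map_smul c v

lemma IsEGCM.S_simple_self (hA : IsEGCM A) (i : Fin n) : S A i (simple i) = -simple i := by
  rw [S_simple, hA.1, two_smul]
  abel

lemma IsEGCM.S_mul_self (hA : IsEGCM A) (i : Fin n) : S A i * S A i = 1 := by
  funext v
  have hneg : S A i ((-(∑ k, A i k * v k)) • simple i) = (∑ k, A i k * v k) • simple i := by
    rw [S_smul, hA.S_simple_self]
    simp
  change S A i (S A i v) = v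
  rw [S_apply i v, sub_eq_add_neg, ← neg_smul, S_add, hneg, S_apply]
  abel

lemma IsEGCM.wordProd_injective (hA : IsEGCM A) (l : List (Fin n)) :
    Function.Injective (wordProd A l) := by
  induction l with
  | nil => exact fun _ _ h => h
  | cons i l ih =>
    intro u v h
    rw [wordProd_cons, end_mul_apply, end_mul_apply] at h
    apply ih
    have happly := congrArg (S A i) h
    rwa [← end_mul_apply (S A i), ← end_mul_apply (S A i), hA.S_mul_self] at happly

/-! ### Alternating words -/

lemma wordProd_alternatingWord_even (i j : Fin n) (k : ℕ) :
    wordProd A (alternatingWord i j (2 * k)) = (S A i * S A j) ^ k := by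
  induction k with
  | zero => rfl
  | succ k ih =>
    rw [show 2 * (k + 1) = 2 * k + 1 + 1 by ring, CoxeterSystem.alternatingWord_succ,
      CoxeterSystem.alternatingWord_succ, List.concat_eq_append, List.concat_eq_append,
      wordProd_append, wordProd_append, ih, pow_succ]
    simp [mul_assoc]

lemma vO_eq_wordProd {i j : Fin n} (h : Odd (mval A i j)) :
    vO A j i = wordProd A (alternatingWord i j (mval A i j - 1)) := by
  obtain ⟨k, hk⟩ := h
  rw [vO, hk, Nat.add_sub_cancel, wordProd_alternatingWord_even]
  simp

lemma vE_eq_wordProd {i j : Fin n} (h0 : mval A i j ≠ 0) (h : Even (mval A i j)) :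
    vE A j i = wordProd A (alternatingWord i j (mval A i j - 1)) := by
  obtain ⟨k, hk⟩ := h
  obtain ⟨l, rfl⟩ : ∃ l, k = l + 1 := ⟨k - 1, by omega⟩
  rw [vE, hk, show (l + 1 + (l + 1) - 2) / 2 = l by omega,
    show l + 1 + (l + 1) - 1 = 2 * l + 1 by omega, CoxeterSystem.alternatingWord_succ',
    if_pos (even_two_mul l), wordProd_cons, wordProd_alternatingWord_even]

lemma exists_append_alternatingWord (i j : Fin n) (d m : ℕ) :
    ∃ l : List (Fin n), l.length = d ∧
      alternatingWord i j (m + d) = l ++ alternatingWord i j m := by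
  induction d with
  | zero => exact ⟨[], rfl, rfl⟩
  | succ d ih =>
    obtain ⟨l, hl, h⟩ := ih
    refine ⟨(if Even (m + d) then j else i) :: l, by simp [hl], ?_⟩
    rw [← add_assoc, CoxeterSystem.alternatingWord_succ', h]
    rfl

lemma IsEGCM.wordProd_alternatingWord_simple (hA : IsEGCM A) {i j : Fin n} {t r : ℝ}
    (h : IsDihedralScale A i j t r) (k : ℕ) :
    wordProd A (alternatingWord i j k) (simple i) =
      if Even k then dihedralCoeff t (k + 1) • simple i + (r * dihedralCoeff t k) • simple j
      else dihedralCoeff t k • simple i + (r * dihedralCoeff t (k + 1)) • simple j := by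
  have hji : A j i = -(t * r) := by linarith [h.left]
  have hij : A i j * r = -t := by linarith [h.right]
  induction k with
  | zero => simp [dihedralCoeff, alternatingWord, end_one_apply]
  | succ k ih =>
    rw [CoxeterSystem.alternatingWord_succ', wordProd_cons, end_mul_apply, ih]
    by_cases hk : Even k
    · rw [if_pos hk, if_pos hk, if_neg (by simpa [Nat.even_add_one] using hk), S_add, S_smul,
        S_smul, hA.S_simple_self, S_simple, hji, dihedralCoeff]
      module
    · rw [if_neg hk, if_neg hk, if_pos (by simpa [Nat.even_add_one] using hk), S_add, S_smul,
        S_smul, hA.S_simple_self, S_simple, dihedralCoeff, smul_sub, smul_smul,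
        show r * dihedralCoeff t (k + 1) * A i j = dihedralCoeff t (k + 1) * (A i j * r) by ring,
        hij]
      module

lemma eq_or_eq_of_mem_alternatingWord {i j a : Fin n} {k : ℕ}
    (h : a ∈ alternatingWord i j k) : a = i ∨ a = j := by
  induction k with
  | zero => simp [alternatingWord] at h
  | succ k ih =>
    rw [CoxeterSystem.alternatingWord_succ', List.mem_cons] at h
    rcases h with h | h
    · split_ifs at h
      · exact Or.inr h
      · exact Or.inl h
    · exact ih h

lemma wordProd_eq_self {l : List (Fin n)} {v : Fin n → ℝ} (h : ∀ a ∈ l, S A a v = v) :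
    wordProd A l v = v := by
  induction l with
  | nil => rfl
  | cons a l ih =>
    rw [wordProd_cons, end_mul_apply, ih fun b hb => h b (List.mem_cons_of_mem _ hb)]
    exact h a List.mem_cons_self

lemma IsEGCM.wordProd_braid_simple (hA : IsEGCM A) {i j : Fin n} (hij : i ≠ j)
    (hm : mval A i j ≠ 0) :
    wordProd A (alternatingWord i j (mval A i j)) (simple i) =
      wordProd A (alternatingWord j i (mval A i j)) (simple i) := by
  obtain ⟨t, r, h⟩ := hA.exists_isDihedralScale hij
  obtain ⟨hm2, rfl⟩ := h.cases.resolve_left fun h0 => hm h0.1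
  have hleft := hA.wordProd_alternatingWord_simple h (mval A i j)
  have hright := hA.wordProd_alternatingWord_simple h (mval A i j - 1)
  have hsucc : mval A i j - 1 + 1 = mval A i j := by omega
  have hword : alternatingWord j i (mval A i j) =
      alternatingWord i j (mval A i j - 1) ++ [i] := by
    conv_lhs => rw [← hsucc]
    rw [CoxeterSystem.alternatingWord_succ, List.concat_eq_append]
  have hneg : wordProd A [i] (simple i) = (-1 : ℝ) • simple i := by
    rw [wordProd_cons, wordProd_nil, mul_one, hA.S_simple_self, neg_one_smul]
  rw [hword, wordProd_append, end_mul_apply, hneg, wordProd_smul, hleft, hright, hsucc,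
    dihedralCoeff_self hm2, dihedralCoeff_pred hm2, dihedralCoeff_succ_self hm2]
  have hpar : Even (mval A i j - 1) ↔ ¬ Even (mval A i j) := by
    conv_rhs => rw [← hsucc, Nat.even_add_one, not_not]
  by_cases he : Even (mval A i j)
  · rw [if_pos he, if_neg (by rw [hpar]; exact not_not.mpr he)]
    module
  · rw [if_neg he, if_pos (hpar.mpr he)]
    module

/-- The braid relation. -/
lemma IsEGCM.wordProd_braid (hA : IsEGCM A) {i j : Fin n} (hij : i ≠ j)
    (hm : mval A i j ≠ 0) :
    wordProd A (alternatingWord i j (mval A i j)) =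
      wordProd A (alternatingWord j i (mval A i j)) := by
  obtain ⟨hm2, hprod⟩ := mval_spec hm
  have hD : 4 - A i j * A j i ≠ 0 := by
    have hs := sin_pi_div_pos hm2
    have hsc := sin_sq_add_cos_sq (π / mval A i j)
    nlinarith
  funext v
  obtain ⟨p, q, u, hv, hu⟩ : ∃ (p q : ℝ) (u : Fin n → ℝ),
      v = u + p • simple i + q • simple j ∧ ∀ a, a = i ∨ a = j → S A a u = u := by
    set x := ∑ k, A i k * v k with hx
    set y := ∑ k, A j k * v k with hy
    have hform : ∀ a p q, ∑ k, A a k * (v - p • simple i - q • simple j) k =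
        ∑ k, A a k * v k - p * A a i - q * A a j := by
      intro a p q
      simp only [Pi.sub_apply, Pi.smul_apply, smul_eq_mul, mul_sub, Finset.sum_sub_distrib]
      simp [simple, Pi.single_apply, mul_comm]
    refine ⟨(2 * x - A i j * y) / (4 - A i j * A j i),
      (2 * y - A j i * x) / (4 - A i j * A j i),
      v - ((2 * x - A i j * y) / (4 - A i j * A j i)) • simple i -
        ((2 * y - A j i * x) / (4 - A i j * A j i)) • simple j, by abel, ?_⟩
    rintro a (rfl | rfl)
    · rw [S_apply, hform, ← hx, hA.1, sub_eq_self]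
      convert zero_smul ℝ _
      field_simp
      ring
    · rw [S_apply, hform, ← hy, hA.1, sub_eq_self]
      convert zero_smul ℝ _
      field_simp
      ring
  have hfix : ∀ a b k, (a = i ∧ b = j) ∨ (a = j ∧ b = i) →
      wordProd A (alternatingWord a b k) u = u := by
    intro a b k hab
    refine wordProd_eq_self fun c hc => hu c ?_
    rcases eq_or_eq_of_mem_alternatingWord hc with rfl | rfl <;> tauto
  have hj := hA.wordProd_braid_simple hij.symm (by rwa [mval_comm])
  rw [mval_comm] at hj
  rw [hv]
  simp only [wordProd_add, wordProd_smul, hfix i j _ (by simp), hfix j i _ (by simp),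
    hA.wordProd_braid_simple hij hm, hj]

/-! ### Reduced words and positivity -/

/-- `l` is a shortest word for the element it represents. -/
def IsReducedWord (A : Fin n → Fin n → ℝ) (l : List (Fin n)) : Prop :=
  ∀ u, wordProd A u = wordProd A l → l.length ≤ u.length

/-- Multiplying the element represented by `l` by `S A i` on the right does not shorten it. -/
def NoDescent (A : Fin n → Fin n → ℝ) (l : List (Fin n)) (i : Fin n) : Prop :=
  ∀ u, wordProd A u = wordProd A l * S A i → l.length ≤ u.length

lemma exists_isReducedWord (A : Fin n → Fin n → ℝ) (l : List (Fin n)) :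
    ∃ l', wordProd A l' = wordProd A l ∧ IsReducedWord A l' ∧ l'.length ≤ l.length := by
  classical
  have hex : ∃ k, ∃ l', wordProd A l' = wordProd A l ∧ l'.length = k := ⟨_, l, rfl, rfl⟩
  obtain ⟨l', hl', hlen⟩ := Nat.find_spec hex
  refine ⟨l', hl', fun m hm => ?_, ?_⟩ <;> rw [hlen]
  · exact Nat.find_min' hex ⟨m, hm.trans hl', rfl⟩
  · exact Nat.find_min' hex ⟨l, rfl, rfl⟩

lemma IsEGCM.mul_S_mul_S (hA : IsEGCM A) (w : Function.End (Fin n → ℝ)) (i : Fin n) :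
    w * S A i * S A i = w := by
  rw [mul_assoc, hA.S_mul_self, mul_one]

/-- A nonempty reduced word without descent at `i` splits as a reduced word without descents
at `i` and some `j`, followed by a short alternating word in `i, j`. -/
lemma IsEGCM.exists_dihedral_factorization (hA : IsEGCM A) {l : List (Fin n)} {i : Fin n}
    (hl : IsReducedWord A l) (hi : NoDescent A l i) (hne : l ≠ []) :
    ∃ j k l₀, i ≠ j ∧ 0 < k ∧ l₀.length + k = l.length ∧
      wordProd A l = wordProd A l₀ * wordProd A (alternatingWord i j k) ∧
      (mval A i j ≠ 0 → k < mval A i j) ∧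
      IsReducedWord A l₀ ∧ NoDescent A l₀ i ∧ NoDescent A l₀ j := by
  obtain ⟨l₁, j, rfl⟩ : ∃ l₁ j, l = l₁ ++ [j] :=
    ⟨l.dropLast, l.getLast hne, (List.dropLast_append_getLast hne).symm⟩
  have hij : i ≠ j := by
    rintro rfl
    have := hi l₁ (by simp [hA.mul_S_mul_S])
    simp at this
  generalize hl' : l₁ ++ [j] = l at *
  classical
  let P : ℕ → Prop := fun k => ∃ l₀ : List (Fin n), l₀.length + k = l.length ∧
    wordProd A l = wordProd A l₀ * wordProd A (alternatingWord i j k)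
  have hP1 : P 1 := ⟨l₁, by simp [← hl'], by simp [← hl', alternatingWord]⟩
  have hlen : 1 ≤ l.length := by simp [← hl']
  obtain ⟨k, hk1, hPk, hmax⟩ : ∃ k, 1 ≤ k ∧ P k ∧ ¬ P (k + 1) := by
    refine ⟨Nat.findGreatest P l.length, Nat.le_findGreatest hlen hP1,
      Nat.findGreatest_spec hlen hP1, fun h => ?_⟩
    have hle : Nat.findGreatest P l.length + 1 ≤ l.length := by
      obtain ⟨l₀, h₀, -⟩ := h
      omega
    have := Nat.le_findGreatest hle h
    omega
  obtain ⟨l₀, hlen₀, hprod⟩ := hPk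
  have hred₀ : IsReducedWord A l₀ := by
    intro l' h'
    have := hl (l' ++ alternatingWord i j k) (by rw [wordProd_append, h', hprod])
    simp at this
    omega
  -- the leftmost letter of the alternating word cannot be a descent
  have hfirst : NoDescent A l₀ (if Even (k - 1) then j else i) := by
    intro l' h'
    obtain ⟨p, rfl⟩ : ∃ p, k = p + 1 := ⟨k - 1, by omega⟩
    rw [Nat.add_sub_cancel] at h'
    have := hl (l' ++ alternatingWord i j p) (by
      rw [wordProd_append, h', hprod, CoxeterSystem.alternatingWord_succ', wordProd_cons,
        mul_assoc])
    simp at this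
    omega
  -- the other letter is not a descent by maximality of the alternating word
  have hother : NoDescent A l₀ (if Even k then j else i) := by
    intro l' h'
    by_contra! hlt
    have heq : wordProd A l =
        wordProd A l' * wordProd A (alternatingWord i j (k + 1)) := by
      rw [CoxeterSystem.alternatingWord_succ', wordProd_cons, h', ← mul_assoc, hA.mul_S_mul_S,
        hprod]
    have := hl (l' ++ alternatingWord i j (k + 1)) (by rw [wordProd_append, heq])
    simp at this
    exact hmax ⟨l', by omega, heq⟩
  refine ⟨j, k, l₀, hij, hk1, hlen₀, hprod, fun hm => ?_, hred₀, ?_⟩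
  · by_contra! hmk
    obtain ⟨p, hp, hword⟩ := exists_append_alternatingWord i j (k - mval A i j) (mval A i j)
    rw [Nat.add_sub_cancel' hmk] at hword
    obtain ⟨m, hm'⟩ : ∃ m, mval A i j = m + 1 := ⟨mval A i j - 1, by omega⟩
    have := hi (l₀ ++ p ++ alternatingWord i j m) (by
      rw [hprod, hword, wordProd_append p, hA.wordProd_braid hij hm, hm',
        CoxeterSystem.alternatingWord_succ, List.concat_eq_append]
      simp [← mul_assoc, hA.mul_S_mul_S])
    simp at this
    omega
  · obtain ⟨p, rfl⟩ : ∃ p, k = p + 1 := ⟨k - 1, by omega⟩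
    rw [Nat.add_sub_cancel] at hfirst
    by_cases hp : Even p
    · rw [if_pos hp] at hfirst
      rw [if_neg (by rwa [Nat.even_add_one, not_not])] at hother
      exact ⟨hother, hfirst⟩
    · rw [if_neg hp] at hfirst
      rw [if_pos (Nat.even_add_one.mpr hp)] at hother
      exact ⟨hfirst, hother⟩

/-- The coefficients of an image of `simple i` under a short alternating word. -/
lemma IsEGCM.exists_coeff_alternatingWord (hA : IsEGCM A) {i j : Fin n} (hij : i ≠ j) {k : ℕ}
    (hk : 0 < k) (hkm : mval A i j ≠ 0 → k < mval A i j) :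
    ∃ c d : ℝ, wordProd A (alternatingWord i j k) (simple i) = c • simple i + d • simple j ∧
      ((0 < c ∧ 0 < d) ∨ (mval A i j = k + 1 ∧
        ((Odd (mval A i j) ∧ c = 0 ∧ d = Kval A j i ∧ 0 < Kval A j i) ∨
          (Even (mval A i j) ∧ c = 1 ∧ d = 0)))) := by
  obtain ⟨t, r, h⟩ := hA.exists_isDihedralScale hij
  have hform := hA.wordProd_alternatingWord_simple h k
  by_cases hlast : mval A i j = k + 1
  · have hm : mval A i j ≠ 0 := by omega
    obtain ⟨hm2, rfl⟩ := h.cases.resolve_left fun h0 => hm h0.1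
    have hself := dihedralCoeff_self hm2
    have hpred := dihedralCoeff_pred hm2
    rw [show mval A i j - 1 = k by omega] at hpred
    nth_rw 2 [hlast] at hself
    rw [hself, hpred] at hform
    by_cases hk' : Even k
    · rw [if_pos hk'] at hform
      have hK : Kval A j i = r := by
        have hc : 0 < cos (π / mval A i j) := cos_pi_div_pos (by
          obtain ⟨p, rfl⟩ := hk'
          omega)
        rw [Kval, mval_comm A j i, h.left]
        field_simp
      refine ⟨0, Kval A j i, by rw [hform, hK, mul_one], Or.inr ⟨hlast, Or.inl
        ⟨by rw [hlast]; exact hk'.add_one, rfl, rfl, hK ▸ h.pos⟩⟩⟩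
    · rw [if_neg hk'] at hform
      refine ⟨1, 0, by rw [hform, mul_zero], Or.inr ⟨hlast, Or.inr
        ⟨by rw [hlast, Nat.even_add_one]; exact hk', rfl, rfl⟩⟩⟩
  · have hpos : 0 < dihedralCoeff t k ∧ 0 < dihedralCoeff t (k + 1) := by
      rcases h.cases with ⟨-, ht⟩ | ⟨hm2, rfl⟩
      · exact ⟨dihedralCoeff_pos_of_two_le ht hk, dihedralCoeff_pos_of_two_le ht k.succ_pos⟩
      · have := hkm (by omega)
        exact ⟨dihedralCoeff_pos_of_lt hm2 hk this,
          dihedralCoeff_pos_of_lt hm2 k.succ_pos (by omega)⟩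
    by_cases hk' : Even k
    · rw [if_pos hk'] at hform
      exact ⟨_, _, hform, Or.inl ⟨hpos.2, mul_pos h.pos hpos.1⟩⟩
    · rw [if_neg hk'] at hform
      exact ⟨_, _, hform, Or.inl ⟨hpos.1, mul_pos h.pos hpos.2⟩⟩

/-- If `i` is not a descent of a reduced word, then the word sends `simple i` to a
nonnegative combination of simple roots. -/
lemma IsEGCM.wordProd_simple_nonneg (hA : IsEGCM A) {l : List (Fin n)} {i : Fin n}
    (hl : IsReducedWord A l) (hi : NoDescent A l i) : 0 ≤ wordProd A l (simple i) := by
  induction hN : l.length using Nat.strong_induction_on generalizing l i with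
  | _ N ih =>
    rcases eq_or_ne l [] with rfl | hne
    · exact Pi.single_nonneg.mpr zero_le_one
    obtain ⟨j, k, l₀, hij, hk, hlen, hprod, hkm, hred, hdi, hdj⟩ :=
      hA.exists_dihedral_factorization hl hi hne
    obtain ⟨c, d, hcd, hcases⟩ := hA.exists_coeff_alternatingWord hij hk hkm
    have hc : 0 ≤ c ∧ 0 ≤ d := by
      rcases hcases with h | ⟨-, ⟨-, rfl, rfl, h⟩ | ⟨-, rfl, rfl⟩⟩
      · exact ⟨h.1.le, h.2.le⟩
      · exact ⟨le_rfl, h.le⟩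
      · exact ⟨zero_le_one, le_rfl⟩
    rw [hprod, end_mul_apply, hcd, wordProd_add, wordProd_smul, wordProd_smul]
    exact add_nonneg (smul_nonneg hc.1 (ih _ (by omega) hred hdi rfl))
      (smul_nonneg hc.2 (ih _ (by omega) hred hdj rfl))

lemma IsEGCM.noDescent_of_wordProd_simple (hA : IsEGCM A) {l : List (Fin n)} {i x : Fin n}
    {K : ℝ} (hl : IsReducedWord A l) (hK : 0 < K)
    (hact : wordProd A l (simple i) = K • simple x) : NoDescent A l i := by
  intro l' h'
  by_contra! hlt
  obtain ⟨l'', h'', hred, hle⟩ := exists_isReducedWord A l'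
  rw [h'] at h''
  have hdesc : NoDescent A l'' i := by
    intro m hm
    rw [h'', hA.mul_S_mul_S] at hm
    have := hl m hm
    omega
  have hpos := hA.wordProd_simple_nonneg hred hdesc x
  rw [h'', end_mul_apply, hA.S_simple_self, ← neg_one_smul ℝ (simple i), wordProd_smul,
    hact] at hpos
  simp [simple] at hpos
  linarith

/-- Two simple roots cannot both be sent to the ray of a single simple root. -/
lemma IsEGCM.not_proportional (hA : IsEGCM A) {l : List (Fin n)} {i j x : Fin n} {c d K : ℝ}
    (hij : i ≠ j) (hc : 0 < c) (hd : 0 < d) (hi : 0 ≤ wordProd A l (simple i))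
    (hj : 0 ≤ wordProd A l (simple j)) :
    wordProd A l (c • simple i + d • simple j) ≠ K • simple x := by
  intro h
  rw [wordProd_add, wordProd_smul, wordProd_smul] at h
  have hzero : ∀ y, y ≠ x → wordProd A l (simple i) y = 0 ∧ wordProd A l (simple j) y = 0 := by
    intro y hy
    have hy' := congrFun h y
    simp only [Pi.add_apply, Pi.smul_apply, smul_eq_mul, simple, Pi.single_eq_of_ne hy,
      mul_zero] at hy'
    have hiy : 0 ≤ wordProd A l (simple i) y := hi y
    have hjy : 0 ≤ wordProd A l (simple j) y := hj y
    simp only [simple] at hiy hjy ⊢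
    constructor <;> nlinarith
  set p := wordProd A l (simple i) x with hp
  set q := wordProd A l (simple j) x with hq
  have hker : wordProd A l (q • simple i + (-p) • simple j) =
      wordProd A l ((0 : ℝ) • simple i) := by
    rw [wordProd_add, wordProd_smul, wordProd_smul, wordProd_smul, zero_smul]
    funext y
    by_cases hy : y = x
    · subst hy
      simp [← hp, ← hq, mul_comm]
    · simp [hzero y hy]
  have hcomb := hA.wordProd_injective l hker
  have hp0 : p = 0 := by simpa [simple, hij.symm] using congrFun hcomb j
  have hi0 : wordProd A l (simple i) = wordProd A l ((0 : ℝ) • simple i) := by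
    rw [wordProd_smul, zero_smul]
    funext y
    by_cases hy : y = x
    · subst hy
      exact hp0
    · exact (hzero y hy).1
  simpa [simple] using congrFun (hA.wordProd_injective l hi0) i

/-! ### Assembling the path -/

lemma wER_cons (i j : Fin n) (s : List (Fin n)) :
    wER A i (j :: s) = wER A i s * vE A j i := by
  simp [wER]

lemma altProd_cons_ER (i j : Fin n) (s : List (Fin n)) (L : List (Fin n × List (Fin n))) :
    altProd A ((i, j :: s) :: L) = altProd A ((i, s) :: L) * vE A j i := by
  cases L <;> simp [altProd, wER_cons, mul_assoc]

/-- `L` records an ON-path from `i` to `x` with ER-sequences, and represents `w` and `K`. -/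
def IsPathFactorization (A : Fin n → Fin n → ℝ) (w : Function.End (Fin n → ℝ)) (i x : Fin n)
    (K : ℝ) (L : List (Fin n × List (Fin n))) : Prop :=
  L ≠ [] ∧ IsONPath A (L.map Prod.fst) ∧
    (L.map Prod.fst).head? = some i ∧ (L.map Prod.fst).getLast? = some x ∧
    (∀ p ∈ L, ∀ j ∈ p.2, EvenRel A p.1 j) ∧
    w = altProd A L ∧ K = pathProd A (L.map Prod.fst)

lemma IsPathFactorization.cons_odd {w : Function.End (Fin n → ℝ)} {i j x : Fin n} {K : ℝ}
    {L : List (Fin n × List (Fin n))} (h : IsPathFactorization A w j x K L)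
    (hij : OddNbr A i j) :
    IsPathFactorization A (w * vO A j i) i x (Kval A j i * K) ((i, []) :: L) := by
  obtain ⟨hne, hpath, hhead, hlast, heven, rfl, rfl⟩ := h
  rcases L with _ | ⟨⟨a, s⟩, L⟩
  · exact absurd rfl hne
  obtain rfl : a = j := by simpa using hhead
  refine ⟨by simp, ?_, by simp, ?_, ?_, ?_, ?_⟩
  · exact List.isChain_cons_cons.mpr ⟨hij, hpath⟩
  · simpa using hlast
  · rintro p hp b hb
    rcases List.mem_cons.mp hp with rfl | hp
    · simp at hb
    · exact heven p hp b hb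
  · simp [altProd, wER]
  · simp [pathProd]

lemma IsPathFactorization.cons_even {w : Function.End (Fin n → ℝ)} {i j x : Fin n} {K : ℝ}
    {L : List (Fin n × List (Fin n))} (h : IsPathFactorization A w i x K L)
    (hij : EvenRel A i j) :
    ∃ L', IsPathFactorization A (w * vE A j i) i x K L' := by
  obtain ⟨hne, hpath, hhead, hlast, heven, rfl, rfl⟩ := h
  rcases L with _ | ⟨⟨a, s⟩, L⟩
  · exact absurd rfl hne
  obtain rfl : a = i := by simpa using hhead
  refine ⟨(a, j :: s) :: L, by simp, hpath, by simp, hlast, ?_, (altProd_cons_ER ..).symm, rfl⟩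
  rintro p hp b hb
  rcases List.mem_cons.mp hp with rfl | hp
  · rcases List.mem_cons.mp hb with rfl | hb
    · exact hij
    · exact heven (a, s) List.mem_cons_self b hb
  · exact heven p (List.mem_cons_of_mem _ hp) b hb

lemma IsEGCM.exists_isPathFactorization (hA : IsEGCM A) {l : List (Fin n)} {i x : Fin n} {K : ℝ}
    (hl : IsReducedWord A l) (hK : 0 < K) (hact : wordProd A l (simple i) = K • simple x) :
    ∃ L, IsPathFactorization A (wordProd A l) i x K L := by
  induction hN : l.length using Nat.strong_induction_on generalizing l i K with
  | _ N ih =>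
    rcases eq_or_ne l [] with rfl | hne
    · have hact' : simple i = K • simple x := hact
      obtain rfl : i = x := by
        by_contra hix
        simpa [simple, hix] using congrFun hact' i
      obtain rfl : K = 1 := by simpa [simple] using (congrFun hact' i).symm
      exact ⟨[(i, [])], by simp, List.isChain_singleton _, by simp, by simp, by simp,
        by simp [altProd, wER], by simp [pathProd]⟩
    obtain ⟨j, k, l₀, hij, hk, hlen, hprod, hkm, hred, hdi, hdj⟩ :=
      hA.exists_dihedral_factorization hl (hA.noDescent_of_wordProd_simple hl hK hact) hne
    obtain ⟨c, d, hcd, hcases⟩ := hA.exists_coeff_alternatingWord hij hk hkm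
    rw [hprod, end_mul_apply, hcd] at hact
    rcases hcases with ⟨hc, hd⟩ | ⟨hm, ⟨hodd, rfl, rfl, hpos⟩ | ⟨heven, rfl, rfl⟩⟩
    · exact absurd hact (hA.not_proportional hij hc hd (hA.wordProd_simple_nonneg hred hdi)
        (hA.wordProd_simple_nonneg hred hdj))
    · rw [zero_smul, zero_add, wordProd_smul] at hact
      have hact' : wordProd A l₀ (simple j) = (K / Kval A j i) • simple x := by
        rw [div_eq_inv_mul, mul_smul]
        exact (eq_inv_smul_iff₀ hpos.ne').mpr hact
      obtain ⟨L, hL⟩ := ih _ (by omega) hred (div_pos hK hpos) hact' rfl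
      have := hL.cons_odd ⟨hij, hodd⟩
      rw [mul_div_cancel₀ _ hpos.ne', vO_eq_wordProd hodd, hm, Nat.add_sub_cancel, ← hprod] at this
      exact ⟨_, this⟩
    · rw [zero_smul, add_zero, one_smul] at hact
      obtain ⟨L, hL⟩ := ih _ (by omega) hred hK hact rfl
      have := hL.cons_even ⟨hij, by omega, heven⟩
      rwa [vE_eq_wordProd (by omega) heven, hm, Nat.add_sub_cancel, ← hprod] at this

/-- Theorem 3.2, "only if": if `w ≠ ε` and `w.α_i = Kα_x` with `K > 0`,
then there are an ON-path `𝒫` from `γ_i` to `γ_x` and ER-sequences `𝒮_k` rooted at its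
nodes such that `w = w_{𝒮_p} v_{i_p i_{p-1}} ⋯ v_{i_1 i_0} w_{𝒮_0}` and `K = Π_𝒫`. -/
theorem stmt13 (A : Fin n → Fin n → ℝ) (hA : IsEGCM A)
    (w : Function.End (Fin n → ℝ)) (hw : w ∈ Wgrp A) (hne : w ≠ 1)
    (i x : Fin n) (K : ℝ) (hK : 0 < K) (hact : w (simple i) = K • simple x) :
    ∃ L : List (Fin n × List (Fin n)), L ≠ [] ∧
      IsONPath A (L.map Prod.fst) ∧
      (L.map Prod.fst).head? = some i ∧ (L.map Prod.fst).getLast? = some x ∧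
      (∀ p ∈ L, ∀ j ∈ p.2, EvenRel A p.1 j) ∧
      w = altProd A L ∧ K = pathProd A (L.map Prod.fst) := by
  obtain ⟨l, rfl⟩ := exists_wordProd_of_mem_Wgrp hw
  obtain ⟨l', hl', hred, -⟩ := exists_isReducedWord A l
  rw [← hl'] at hact ⊢
  exact hA.exists_isPathFactorization hred hK hact
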